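/- arXiv:1807.05883 — 2 statements merged into one kernel-verified Lean document; each statement's English description precedes it below -/
import Mathlib

section
/- Let r ≥ 0 be an integer. Suppose (p₀,p₁,p₂,p₃) is a piecewise polynomial vector field of degree ≤ r on the Alfeld split T^z of a tetrahedron T ⊂ ℝ³ such that its normal component is single-valued across interior faces ((p_i − p_j) · n_{ij} = 0 at every point of F_{ij} for all i ≠ j) and div p_i = 0 identically for each i. Then there exists a piecewise polynomial vector field (q₀,q₁,q₂,q₃) of degree ≤ r+1 on T^z which is continuous across interior faces (q_i = q_j on F_{ij} for all i ≠ j) and satisfies curl q_i = p_i for each i. -/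
open MvPolynomial Matrix

noncomputable section

namespace Alfeld

abbrev V3 : Type := Fin 3 → ℝ
abbrev P3 : Type := MvPolynomial (Fin 3) ℝ
abbrev VP3 : Type := Fin 3 → P3

/-- Cross product of vectors in `ℝ³`. -/
def cross3 (u v : V3) : V3 := fun c => u (c + 1) * v (c + 2) - u (c + 2) * v (c + 1)

/-- Evaluation of a polynomial vector field at a point. -/
def evalV (p : VP3) (y : V3) : V3 := fun c => eval y (p c)

/-- Gradient of a polynomial. -/
def pgrad (q : P3) : VP3 := fun c => pderiv c q

/-- Curl of a polynomial vector field. -/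
def pcurl (p : VP3) : VP3 := fun c => pderiv (c + 1) (p (c + 2)) - pderiv (c + 2) (p (c + 1))

/-- Divergence of a polynomial vector field. -/
def pdiv (p : VP3) : P3 := ∑ c, pderiv c (p c)

/-- Cross product of polynomial vector fields. -/
def pcross (u v : VP3) : VP3 := fun c => u (c + 1) * v (c + 2) - u (c + 2) * v (c + 1)

/-- All components have total degree at most `r`. -/
def degVle (p : VP3) (r : ℕ) : Prop := ∀ c, (p c).totalDegree ≤ r

/-- Barycenter of the tetrahedron with vertices `x 0, x 1, x 2, x 3`. -/
def bary (x : Fin 4 → V3) : V3 := (4 : ℝ)⁻¹ • (x 0 + x 1 + x 2 + x 3)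

/-- The piece `T_i` of the Alfeld split. -/
def piece (x : Fin 4 → V3) (i : Fin 4) : Set V3 :=
  convexHull ℝ (insert (bary x) (x '' {j | j ≠ i}))

/-- The interior face `F_{ij} = T_i ∩ T_j`. -/
def intFace (x : Fin 4 → V3) (i j : Fin 4) : Set V3 :=
  convexHull ℝ (insert (bary x) (x '' {k | k ≠ i ∧ k ≠ j}))

/-- The boundary face of `T` opposite the vertex `x i`. -/
def bdryFace (x : Fin 4 → V3) (i : Fin 4) : Set V3 :=
  convexHull ℝ (x '' {j | j ≠ i})

/-- `n` is a (Euclidean) unit normal of the interior face `F_{ij}`. -/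
def IsUnitNormalInt (x : Fin 4 → V3) (i j : Fin 4) (n : V3) : Prop :=
  n ⬝ᵥ n = 1 ∧ ∀ k, k ≠ i → k ≠ j → n ⬝ᵥ (x k - bary x) = 0

/-- `n` is a (Euclidean) unit normal of the boundary face `F_i`. -/
def IsUnitNormalBdry (x : Fin 4 → V3) (i : Fin 4) (n : V3) : Prop :=
  n ⬝ᵥ n = 1 ∧ ∀ j k, j ≠ i → k ≠ i → n ⬝ᵥ (x k - x j) = 0

/-- The vertices of the Alfeld split. -/
def vertices (x : Fin 4 → V3) : Set V3 := insert (bary x) (Set.range x)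

/-- Jacobian matrix of a polynomial vector field at a point. -/
def jacob (p : VP3) (a : V3) : Fin 3 → Fin 3 → ℝ := fun c d => eval a (pderiv d (p c))

end Alfeld

open Alfeld

namespace Alfeld

/-- The linear operator multiplying each monomial of degree `k` by `c k`. -/
def radialMul (c : ℕ → ℝ) : P3 →ₗ[ℝ] P3 :=
  (basisMonomials (Fin 3) ℝ).constr ℝ fun d => monomial d (c d.degree)

theorem radialMul_monomial (c : ℕ → ℝ) (d : Fin 3 →₀ ℕ) (a : ℝ) :
    radialMul c (monomial d a) = monomial d (c d.degree * a) := by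
  have h : (monomial d a : P3) = a • basisMonomials (Fin 3) ℝ d := by
    simp [smul_monomial]
  rw [h, map_smul, radialMul, Module.Basis.constr_basis, smul_monomial, smul_eq_mul, mul_comm]

theorem coeff_radialMul (c : ℕ → ℝ) (f : P3) (d : Fin 3 →₀ ℕ) :
    coeff d (radialMul c f) = c d.degree * coeff d f := by
  induction f using MvPolynomial.induction_on' with
  | monomial e a =>
    rw [radialMul_monomial, coeff_monomial, coeff_monomial]
    split_ifs with h <;> simp [h]
  | add f g hf hg => simp [hf, hg, mul_add]

theorem radialMul_X_mul (c : ℕ → ℝ) (i : Fin 3) (f : P3) :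
    radialMul c (X i * f) = X i * radialMul (fun k => c (k + 1)) f := by
  induction f using MvPolynomial.induction_on' with
  | monomial e a =>
    rw [radialMul_monomial, X, monomial_mul, monomial_mul, radialMul_monomial]
    simp [add_comm]
  | add f g hf hg => simp [hf, hg, mul_add]

theorem pderiv_radialMul (c : ℕ → ℝ) (i : Fin 3) (f : P3) :
    pderiv i (radialMul c f) = radialMul (fun k => c (k + 1)) (pderiv i f) := by
  ext d
  simp [coeff_pderiv, coeff_radialMul]
  ring

theorem sum_X_mul_pderiv_radialMul (c : ℕ → ℝ) (f : P3) :
    ∑ i, X i * pderiv i (radialMul c f) = radialMul (fun k => k * c k) f := by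
  induction f using MvPolynomial.induction_on' with
  | monomial e a =>
    simp only [radialMul_monomial, X_mul_pderiv_monomial, ← Finset.sum_smul]
    rw [← map_nsmul, nsmul_eq_mul, mul_assoc, Finsupp.degree_eq_sum]
  | add f g hf hg => simp only [map_add, mul_add, Finset.sum_add_distrib, hf, hg]

theorem radialMul_add_radialMul (c c' : ℕ → ℝ) (f : P3) :
    radialMul c f + radialMul c' f = radialMul (fun k => c k + c' k) f := by
  ext d
  simp [coeff_radialMul, add_mul]

theorem radialMul_eq_self {c : ℕ → ℝ} {f : P3} (h : ∀ k ≤ f.totalDegree, c k = 1) :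
    radialMul c f = f := by
  ext d
  rw [coeff_radialMul]
  by_cases hd : coeff d f = 0
  · simp [hd]
  · rw [h _ (le_trans (le_of_eq (by rw [Finsupp.degree]; rfl))
      (le_totalDegree (mem_support_iff.2 hd))), one_mul]

theorem totalDegree_radialMul_le {c : ℕ → ℝ} {n : ℕ} (h : ∀ k, n < k → c k = 0) (f : P3) :
    (radialMul c f).totalDegree ≤ n := by
  refine Finset.sup_le ?_
  intro d hd
  by_contra! hn
  change n < d.degree at hn
  rw [mem_support_iff, coeff_radialMul, h _ hn, zero_mul] at hd
  exact hd rfl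

/-- The linear form with coefficient vector `u`. -/
def linForm (u : V3) : P3 := ∑ c, C (u c) * X c

theorem eval_linForm (u y : V3) : eval y (linForm u) = u ⬝ᵥ y := by
  simp [linForm, dotProduct]

theorem pderiv_linForm (u : V3) (c : Fin 3) : pderiv c (linForm u) = C (u c) := by
  simp [linForm, pderiv_X, Pi.single_apply]

theorem linForm_sub (u u' : V3) : linForm (u - u') = linForm u - linForm u' := by
  simp [linForm, sub_mul]

theorem radialMul_C_mul (c : ℕ → ℝ) (a : ℝ) (f : P3) :
    radialMul c (C a * f) = C a * radialMul c f := by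
  rw [C_mul', map_smul, C_mul']

theorem linForm_dvd_radialMul (c : ℕ → ℝ) {u : V3} {f : P3} (h : linForm u ∣ f) :
    linForm u ∣ radialMul c f := by
  obtain ⟨g, rfl⟩ := h
  refine ⟨radialMul (fun k => c (k + 1)) g, ?_⟩
  simp only [linForm, Finset.sum_mul, map_sum, mul_assoc, radialMul_C_mul, radialMul_X_mul]

theorem pderiv_pderiv_comm (i j : Fin 3) (f : P3) :
    pderiv i (pderiv j f) = pderiv j (pderiv i f) := by
  ext d
  simp only [coeff_pderiv, Finsupp.add_apply, Finsupp.single_apply, add_right_comm d]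
  by_cases h : i = j
  · subst h; rfl
  · simp [h, Ne.symm h]; ring

/-- Linear projection along `v` onto the plane `u ⬝ᵥ y = 0`, as a substitution. -/
def planeProj (u v : V3) : P3 →ₐ[ℝ] P3 := aeval fun c => X c - C (v c) * linForm u

theorem eval_planeProj (u v y : V3) (f : P3) :
    eval y (planeProj u v f) = eval (y - (u ⬝ᵥ y) • v) f := by
  rw [planeProj, ← coe_aeval_eq_eval, ← coe_aeval_eq_eval]
  have h : (aeval y : P3 →ₐ[ℝ] ℝ).comp (aeval fun c => X c - C (v c) * linForm u)
      = aeval (y - (u ⬝ᵥ y) • v) := by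
    refine MvPolynomial.algHom_ext fun c => ?_
    simp [eval_linForm, mul_comm]
  exact DFunLike.congr_fun h f

theorem linForm_dvd_sub_planeProj (u v : V3) (f : P3) : linForm u ∣ f - planeProj u v f := by
  induction f using MvPolynomial.induction_on with
  | C a => simp [planeProj]
  | add f g hf hg =>
    rw [map_add, add_sub_add_comm]
    exact dvd_add hf hg
  | mul_X f c hf =>
    have h : f * X c - planeProj u v (f * X c)
        = (f - planeProj u v f) * X c + planeProj u v f * C (v c) * linForm u := by
      rw [map_mul]
      simp only [planeProj, aeval_X]
      ring
    rw [h]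
    exact dvd_add (hf.mul_right _) (dvd_mul_left _ _)

theorem planeProj_linForm (u v u' : V3) :
    planeProj u v (linForm u') = linForm u' - C (u' ⬝ᵥ v) * linForm u := by
  apply MvPolynomial.funext
  intro y
  rw [eval_planeProj]
  simp [eval_linForm, mul_comm]

theorem planeProj_comm {u v u' v' : V3} (h : u ⬝ᵥ v' = 0) (h' : u' ⬝ᵥ v = 0) (f : P3) :
    planeProj u v (planeProj u' v' f) = planeProj u' v' (planeProj u v f) := by
  apply MvPolynomial.funext
  intro y
  simp only [eval_planeProj]
  congr 2
  simp [h, h']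
  abel

theorem linForm_dvd_iff {u v : V3} (h : u ⬝ᵥ v = 1) (f : P3) :
    linForm u ∣ f ↔ planeProj u v f = 0 := by
  constructor
  · rintro ⟨g, rfl⟩
    rw [map_mul, planeProj_linForm, h]
    simp
  · intro hf
    simpa [hf] using linForm_dvd_sub_planeProj u v f

theorem prime_linForm {u v : V3} (h : u ⬝ᵥ v = 1) : Prime (linForm u) := by
  refine ⟨?_, ?_, ?_⟩
  · intro h0
    have := eval_linForm u v
    simp [h0, h] at this
  · intro hu
    have := hu.map (eval (0 : V3))
    rw [eval_linForm, dotProduct_zero] at this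
    exact not_isUnit_zero this
  · intro f g
    simp only [linForm_dvd_iff h, map_mul, mul_eq_zero, imp_self]

theorem eval_eq_of_linForm_dvd {u y : V3} {f g : P3} (h : linForm u ∣ f - g) (hy : u ⬝ᵥ y = 0) :
    eval y f = eval y g := by
  obtain ⟨k, hk⟩ := h
  have := congrArg (eval y) hk
  simpa [eval_linForm, hy, sub_eq_zero] using this

/-- A polynomial vanishing on a nonempty relatively open part of a plane is divisible
by the linear form defining the plane. -/
theorem linForm_dvd_of_eventually {u v y₀ : V3} (h : u ⬝ᵥ v = 1) {f : P3}
    (hf : ∀ᶠ y in nhds y₀, eval (y - (u ⬝ᵥ y) • v) f = 0) : linForm u ∣ f := by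
  rw [linForm_dvd_iff h]
  have han (g : P3) : AnalyticOnNhd ℝ (fun y : V3 => eval y g) Set.univ := by
    exact AnalyticOnNhd.eval_mvPolynomial g
  have := (han (planeProj u v f)).eq_of_eventuallyEq (han 0) (z₀ := y₀)
    (by filter_upwards [hf] with y hy; simpa [eval_planeProj] using hy)
  exact MvPolynomial.funext fun y => congrFun this y

/-- The Koszul-type potential of a divergence-free field: `∫₀¹ t p(t y) × y dt`. -/
def koszul (p : VP3) : VP3 := pcross (fun c => radialMul (fun k => ((k : ℝ) + 2)⁻¹) (p c)) X

theorem koszul_sub (p p' : VP3) : koszul (p - p') = koszul p - koszul p' := by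
  funext c
  simp only [koszul, pcross, Pi.sub_apply, map_sub]
  ring

theorem pcurl_koszul {p : VP3} (h : pdiv p = 0) : pcurl (koszul p) = p := by
  have hdiv : ∑ c, pderiv c (radialMul (fun k => ((k : ℝ) + 2)⁻¹) (p c)) = 0 := by
    simp only [pderiv_radialMul, ← map_sum]
    rw [show ∑ c, pderiv c (p c) = 0 from h, map_zero]
  have heuler (c : Fin 3) : ∑ i, X i * pderiv i (radialMul (fun k => ((k : ℝ) + 2)⁻¹) (p c))
      + 2 * radialMul (fun k => ((k : ℝ) + 2)⁻¹) (p c) = p c := by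
    rw [sum_X_mul_pderiv_radialMul, two_mul, radialMul_add_radialMul, radialMul_add_radialMul]
    apply radialMul_eq_self
    intro k _
    field_simp
    norm_num
  funext c
  have hc := heuler c
  unfold koszul
  obtain ⟨u, hu⟩ : ∃ u : VP3, ∀ c, u c = radialMul (fun k => ((k : ℝ) + 2)⁻¹) (p c) :=
    ⟨_, fun _ => rfl⟩
  simp only [← hu] at hc hdiv ⊢
  rw [Fin.sum_univ_three] at hc hdiv
  fin_cases c <;> simp [pcurl, pcross, pderiv_X] at hc ⊢
  · linear_combination hc - X 0 * hdiv
  · linear_combination hc - X 1 * hdiv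
  · linear_combination hc - X 2 * hdiv

theorem pcurl_sub_pgrad (w : VP3) (f : P3) : pcurl (w - pgrad f) = pcurl w := by
  funext c
  simp only [pcurl, pgrad, Pi.sub_apply, map_sub, pderiv_pderiv_comm (c + 1) (c + 2)]
  ring

/-- If the normal component of a field vanishes on a plane through the origin, then so does the
tangential component of its Koszul potential. -/
theorem linForm_dvd_koszul {n v : V3} (hnv : n ⬝ᵥ v = 1) {d : VP3}
    (h : linForm n ∣ ∑ c, C (n c) * d c) (c : Fin 3) :
    linForm n ∣ koszul d c - (∑ e, C (v e) * koszul d e) * C (n c) := by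
  have h' : linForm n ∣ ∑ c, C (n c) * radialMul (fun k => ((k : ℝ) + 2)⁻¹) (d c) := by
    simp only [← radialMul_C_mul, ← map_sum]
    exact linForm_dvd_radialMul _ h
  have hnv' : ∑ c, C (n c) * C (v c) = (1 : P3) := by
    simp only [← C_mul, ← map_sum]
    rw [← C_1, ← hnv, dotProduct]
  obtain ⟨k, hk⟩ := h'
  unfold koszul
  obtain ⟨u, hu⟩ : ∃ u : VP3, ∀ c, u c = radialMul (fun k => ((k : ℝ) + 2)⁻¹) (d c) :=
    ⟨_, fun _ => rfl⟩
  simp only [← hu] at hk ⊢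
  refine ⟨-(pcross (fun e => C (v e)) (fun e => u e - X e * k) c), ?_⟩
  simp only [linForm, Fin.sum_univ_three, pcross] at hk hnv' ⊢
  fin_cases c <;> simp
  · linear_combination (C (v 1) * X 2 - C (v 2) * X 1) * hk - (u 1 * X 2 - u 2 * X 1) * hnv'
  · linear_combination (C (v 2) * X 0 - C (v 0) * X 2) * hk - (u 2 * X 0 - u 0 * X 2) * hnv'
  · linear_combination (C (v 0) * X 1 - C (v 1) * X 0) * hk - (u 0 * X 1 - u 1 * X 0) * hnv'

/-- Inclusion-exclusion: values prescribed on three coordinate planes and compatible on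
their pairwise intersections are attained by a single function. -/
theorem exists_dvd_sub_of_compatible {R : Type*} [CommRing R] {π₁ π₂ π₃ : R →+* R} {l₁ l₂ l₃ : R}
    (h₁ : ∀ f, l₁ ∣ f ↔ π₁ f = 0) (h₂ : ∀ f, l₂ ∣ f ↔ π₂ f = 0) (h₃ : ∀ f, l₃ ∣ f ↔ π₃ f = 0)
    (i₁ : ∀ f, π₁ (π₁ f) = π₁ f) (i₂ : ∀ f, π₂ (π₂ f) = π₂ f) (i₃ : ∀ f, π₃ (π₃ f) = π₃ f)
    (c₁₂ : ∀ f, π₁ (π₂ f) = π₂ (π₁ f)) (c₁₃ : ∀ f, π₁ (π₃ f) = π₃ (π₁ f))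
    (c₂₃ : ∀ f, π₂ (π₃ f) = π₃ (π₂ f)) {g₁ g₂ g₃ : R}
    (e₁₂ : π₁ (π₂ g₁) = π₁ (π₂ g₂)) (e₁₃ : π₁ (π₃ g₁) = π₁ (π₃ g₃))
    (e₂₃ : π₂ (π₃ g₂) = π₂ (π₃ g₃)) :
    ∃ b, l₁ ∣ b - g₁ ∧ l₂ ∣ b - g₂ ∧ l₃ ∣ b - g₃ := by
  refine ⟨π₁ g₁ + π₂ g₂ + π₃ g₃ - π₁ (π₂ g₁) - π₁ (π₃ g₁) - π₂ (π₃ g₂) + π₁ (π₂ (π₃ g₁)), ?_⟩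
  simp only [h₁, h₂, h₃, map_sub, map_add, i₁, i₂, i₃]
  refine ⟨?_, ?_, ?_⟩
  · have h : π₁ (π₂ (π₃ g₁)) = π₁ (π₂ (π₃ g₂)) := by rw [c₂₃, c₂₃, c₁₃, c₁₃, e₁₂]
    linear_combination h - e₁₂ - e₁₃
  · simp only [← c₁₂, i₂]
    linear_combination -e₂₃
  · simp only [← c₁₃, ← c₂₃, i₃]
    ring

/-- Newton interpolation at the nodes `l i`, without division. -/
theorem exists_polynomial_eval_eq {R ι : Type*} [CommRing R] [DecompositionMonoid R]
    [DecidableEq ι] {l b : ι → R}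
    (hl : ∀ i j k, i ≠ k → j ≠ k → i ≠ j → IsRelPrime (l k - l i) (l k - l j))
    (hb : ∀ i j, l i - l j ∣ b i - b j) (s : Finset ι) :
    ∃ B : Polynomial R, ∀ i ∈ s, B.eval (l i) = b i := by
  induction s using Finset.induction_on with
  | empty => exact ⟨0, by simp⟩
  | insert k s hk ih =>
    obtain ⟨B, hB⟩ := ih
    have hdvd : ∏ i ∈ s, (l k - l i) ∣ b k - B.eval (l k) := by
      apply Finset.prod_dvd_of_isRelPrime
      · intro i hi j hj hij
        exact hl i j k (fun h => hk (h ▸ hi)) (fun h => hk (h ▸ hj)) hij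
      · intro i hi
        have h := dvd_sub (hb k i) (Polynomial.sub_dvd_eval_sub (l k) (l i) B)
        rwa [hB i hi, sub_sub_sub_cancel_right] at h
    obtain ⟨a, ha⟩ := hdvd
    refine ⟨B + Polynomial.C a * ∏ i ∈ s, (Polynomial.X - Polynomial.C (l i)), fun i hi => ?_⟩
    rcases Finset.mem_insert.1 hi with rfl | hi
    · simp only [Polynomial.eval_add, Polynomial.eval_mul, Polynomial.eval_C,
        Polynomial.eval_prod, Polynomial.eval_sub, Polynomial.eval_X]
      linear_combination -ha
    · simp only [Polynomial.eval_add, Polynomial.eval_mul, Polynomial.eval_C,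
        Polynomial.eval_prod, Polynomial.eval_sub, Polynomial.eval_X]
      rw [Finset.prod_eq_zero hi (sub_self _), hB i hi]
      ring

/-- A field `B(λ) ∇λ` is a gradient up to a continuous field. -/
theorem exists_pderiv_sub_dvd {ι : Type*} (N : ι → V3) (B : Polynomial P3) :
    ∃ φ : ι → P3, ∀ i j c, linForm (N i - N j) ∣
      (pderiv c (φ i) - B.eval (linForm (N i)) * C (N i c)) -
        (pderiv c (φ j) - B.eval (linForm (N j)) * C (N j c)) := by
  induction B using Polynomial.induction_on' with
  | add B B' h h' =>
    obtain ⟨φ, h⟩ := h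
    obtain ⟨φ', h'⟩ := h'
    refine ⟨φ + φ', fun i j c => (dvd_add (h i j c) (h' i j c)).trans (dvd_of_eq ?_)⟩
    simp only [Pi.add_apply, map_add, Polynomial.eval_add]
    ring
  | monomial m a =>
    refine ⟨fun i => C ((m : ℝ) + 1)⁻¹ * (a * linForm (N i) ^ (m + 1)), fun i j c => ?_⟩
    have h (i : ι) : pderiv c (C ((m : ℝ) + 1)⁻¹ * (a * linForm (N i) ^ (m + 1)))
        - (Polynomial.monomial m a).eval (linForm (N i)) * C (N i c)
        = C ((m : ℝ) + 1)⁻¹ * pderiv c a * linForm (N i) ^ (m + 1) := by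
      have hm : (C ((m : ℝ) + 1)⁻¹ : P3) * (m + 1) = 1 := by
        have h1 : ((m : ℝ) + 1)⁻¹ * (m + 1) = 1 := inv_mul_cancel₀ (by positivity)
        simpa using congrArg (C : ℝ → P3) h1
      simp only [pderiv_C, pderiv_mul, pderiv_pow, pderiv_linForm, Polynomial.eval_monomial,
        Nat.add_sub_cancel]
      push_cast
      linear_combination a * linForm (N i) ^ m * C (N i c) * hm
    rw [h, h, ← mul_sub, linForm_sub]
    exact (sub_dvd_pow_sub_pow _ _ _).mul_left _

theorem planeProj_idem {u v : V3} (h : u ⬝ᵥ v = 1) (f : P3) :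
    planeProj u v (planeProj u v f) = planeProj u v f := by
  have := (linForm_dvd_iff h _).1 (linForm_dvd_sub_planeProj u v f)
  rw [map_sub, sub_eq_zero] at this
  exact this.symm

theorem sum_C_mul_C (u v : V3) : ∑ c, C (u c) * C (v c) = (C (u ⬝ᵥ v) : P3) := by
  simp [dotProduct]

/-- The normal jump of a tangentially continuous field is the trace of a piecewise polynomial. -/
theorem exists_normal_jump {v N : Fin 4 → V3}
    (hNv : ∀ i j k, (N i - N j) ⬝ᵥ v k = (if i = k then 1 else 0) - (if j = k then 1 else 0))
    {w : Fin 4 → VP3}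
    (hw : ∀ i j, i ≠ j → ∀ c, linForm (N i - N j) ∣ (w i c - w j c) -
      (∑ e, C (v i e) * (w i e - w j e)) * C ((N i - N j) c)) (i : Fin 4) :
    ∃ b : P3, ∀ j, i ≠ j → linForm (N i - N j) ∣ b - ∑ e, C (v i e) * (w i e - w j e) := by
  have hone (j : Fin 4) (hj : i ≠ j) : (N i - N j) ⬝ᵥ (-v j) = 1 := by
    simp [dotProduct_neg, hNv, hj]
  have hzero (j k : Fin 4) (hk : i ≠ k) (hjk : j ≠ k) : (N i - N j) ⬝ᵥ (-v k) = 0 := by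
    simp [dotProduct_neg, hNv, hk, hjk]
  have hcomm (j k : Fin 4) (hj : i ≠ j) (hk : i ≠ k) (hjk : j ≠ k) (f : P3) :=
    planeProj_comm (hzero j k hk hjk) (hzero k j hj hjk.symm) f
  have hcompat (j k : Fin 4) (hj : i ≠ j) (hk : i ≠ k) (hjk : j ≠ k) :
      planeProj (N i - N j) (-v j) (planeProj (N i - N k) (-v k)
        (∑ e, C (v i e) * (w i e - w j e))) =
      planeProj (N i - N j) (-v j) (planeProj (N i - N k) (-v k)
        (∑ e, C (v i e) * (w i e - w k e))) := by
    obtain ⟨ρ, hρ⟩ : ∃ ρ : P3 →ₐ[ℝ] P3, ∀ f, ρ f =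
      planeProj (N i - N j) (-v j) (planeProj (N i - N k) (-v k) f) :=
      ⟨(planeProj (N i - N j) (-v j)).comp (planeProj (N i - N k) (-v k)), fun _ => rfl⟩
    have hij : ρ (linForm (N i - N j)) = 0 := by
      rw [hρ, hcomm j k hj hk hjk, (linForm_dvd_iff (hone j hj) _).1 dvd_rfl, map_zero]
    have hik : ρ (linForm (N i - N k)) = 0 := by
      rw [hρ, (linForm_dvd_iff (hone k hk) _).1 dvd_rfl, map_zero]
    have hjk' : ρ (linForm (N j - N k)) = 0 := by
      rw [← sub_sub_sub_cancel_left (N k) (N j) (N i), linForm_sub, map_sub, hij, hik, sub_zero]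
    have hker {f l : P3} (hl : ρ l = 0) (h : l ∣ f) : ρ f = 0 := by
      obtain ⟨g, rfl⟩ := h
      rw [map_mul, hl, zero_mul]
    have hC (a : ℝ) : ρ (C a) = C a := ρ.commutes a
    have h₁ (c : Fin 3) := hker hij (hw i j hj c)
    have h₂ (c : Fin 3) := hker hjk' (hw j k hjk c)
    have h₃ (c : Fin 3) := hker hik (hw i k hk c)
    rw [← hρ, ← hρ]
    generalize (∑ e, C (v i e) * (w i e - w j e)) = a at *
    generalize (∑ e, C (v i e) * (w i e - w k e)) = b at *
    generalize (∑ e, C (v j e) * (w j e - w k e)) = d at *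
    simp only [map_sub, map_mul, hC] at h₁ h₂ h₃
    have hsum : ∑ c, (ρ a * (C ((N i - N j) c) * C (v i c)) +
        ρ d * (C ((N j - N k) c) * C (v i c)) - ρ b * (C ((N i - N k) c) * C (v i c))) = 0 := by
      refine Finset.sum_eq_zero fun c _ => ?_
      linear_combination C (v i c) * (h₃ c - h₁ c - h₂ c)
    rw [Finset.sum_sub_distrib, Finset.sum_add_distrib, ← Finset.mul_sum, ← Finset.mul_sum,
      ← Finset.mul_sum, sum_C_mul_C, sum_C_mul_C, sum_C_mul_C, hNv, hNv, hNv] at hsum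
    simpa [hj.symm, hk.symm, sub_eq_zero] using hsum
  obtain ⟨j, k, l, hj, hk, hl, hjk, hjl, hkl, hall⟩ : ∃ j k l : Fin 4, i ≠ j ∧ i ≠ k ∧ i ≠ l ∧
      j ≠ k ∧ j ≠ l ∧ k ≠ l ∧ ∀ m, i ≠ m → m = j ∨ m = k ∨ m = l := by
    clear hone hzero hcomm hcompat
    revert i
    decide
  obtain ⟨b, h₁, h₂, h₃⟩ := exists_dvd_sub_of_compatible
    (π₁ := (planeProj (N i - N j) (-v j)).toRingHom)
    (π₂ := (planeProj (N i - N k) (-v k)).toRingHom)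
    (π₃ := (planeProj (N i - N l) (-v l)).toRingHom)
    (linForm_dvd_iff (hone j hj)) (linForm_dvd_iff (hone k hk)) (linForm_dvd_iff (hone l hl))
    (planeProj_idem (hone j hj)) (planeProj_idem (hone k hk)) (planeProj_idem (hone l hl))
    (hcomm j k hj hk hjk) (hcomm j l hj hl hjl) (hcomm k l hk hl hkl)
    (hcompat j k hj hk hjk) (hcompat j l hj hl hjl) (hcompat k l hk hl hkl)
  refine ⟨b, fun m hm => ?_⟩
  rcases hall m hm with rfl | rfl | rfl <;> assumption

theorem isRelPrime_linForm {v N : Fin 4 → V3}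
    (hNv : ∀ i j k, (N i - N j) ⬝ᵥ v k = (if i = k then 1 else 0) - (if j = k then 1 else 0))
    {i j k : Fin 4} (hi : i ≠ k) (hj : j ≠ k) (hij : i ≠ j) :
    IsRelPrime (linForm (N k) - linForm (N i)) (linForm (N k) - linForm (N j)) := by
  rw [← linForm_sub, ← linForm_sub]
  have hp : Prime (linForm (N k - N i)) := prime_linForm (v := v k) (by simp [hNv, hi])
  rw [hp.irreducible.isRelPrime_iff_not_dvd]
  intro h
  rw [← sub_zero (linForm (N k - N j))] at h
  have := eval_eq_of_linForm_dvd (y := v j) h (by simp [hNv, hj.symm, hij])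
  simp [eval_linForm, hNv, hj.symm] at this

/-- A tangentially continuous field becomes continuous after subtracting a gradient. -/
theorem exists_sub_pgrad_dvd {v N : Fin 4 → V3}
    (hNv : ∀ i j k, (N i - N j) ⬝ᵥ v k = (if i = k then 1 else 0) - (if j = k then 1 else 0))
    {w : Fin 4 → VP3}
    (hw : ∀ i j, i ≠ j → ∀ c, linForm (N i - N j) ∣ (w i c - w j c) -
      (∑ e, C (v i e) * (w i e - w j e)) * C ((N i - N j) c)) :
    ∃ φ : Fin 4 → P3, ∀ i j c,
      linForm (N i - N j) ∣ (w i - pgrad (φ i)) c - (w j - pgrad (φ j)) c := by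
  choose b hb using exists_normal_jump hNv hw
  have hneg (i j : Fin 4) : linForm (N j - N i) = -linForm (N i - N j) := by
    simp only [linForm_sub, neg_sub]
  have hjump (i j : Fin 4) (hij : i ≠ j) (c : Fin 3) : linForm (N i - N j) ∣
      (w i c - w j c) - b i * C ((N i - N j) c) := by
    refine (dvd_sub (hw i j hij c) ((hb i j hij).mul_right (C ((N i - N j) c)))).trans
      (dvd_of_eq (by ring))
  have hbb (i j : Fin 4) : linForm (N i) - linForm (N j) ∣ b i - b j := by
    rcases eq_or_ne i j with rfl | hij
    · simp
    rw [← linForm_sub]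
    have h' (c : Fin 3) : linForm (N i - N j) ∣ (b i - b j) * C ((N i - N j) c) := by
      have h := hjump j i hij.symm c
      rw [hneg i j, neg_dvd] at h
      refine (dvd_sub (dvd_neg.2 h) (hjump i j hij c)).trans (dvd_of_eq ?_)
      simp only [Pi.sub_apply, C_sub]
      ring
    have hs : b i - b j = ∑ c, (b i - b j) * C ((N i - N j) c) * C (v i c) := by
      simp only [mul_assoc]
      rw [← Finset.mul_sum, sum_C_mul_C, hNv]
      simp [hij.symm]
    rw [hs]
    exact Finset.dvd_sum fun c _ => (h' c).mul_right _
  obtain ⟨B, hB⟩ := exists_polynomial_eval_eq (l := fun i => linForm (N i))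
    (fun i j k => isRelPrime_linForm hNv) hbb Finset.univ
  obtain ⟨φ, hφ⟩ := exists_pderiv_sub_dvd N B
  refine ⟨φ, fun i j c => ?_⟩
  rcases eq_or_ne i j with rfl | hij
  · simp
  have h := hφ i j c
  rw [hB i (Finset.mem_univ _), hB j (Finset.mem_univ _)] at h
  have h' := (hbb i j).mul_right (C (N j c))
  rw [← linForm_sub] at h'
  refine (dvd_sub (dvd_sub (hjump i j hij c) h) h').trans (dvd_of_eq ?_)
  simp only [Pi.sub_apply, C_sub, pgrad]
  ring

/-- The statement for the fan of cones with apex at the origin. -/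
theorem exists_continuous_potential {v N : Fin 4 → V3}
    (hNv : ∀ i j k, (N i - N j) ⬝ᵥ v k = (if i = k then 1 else 0) - (if j = k then 1 else 0))
    {r : ℕ} {p : Fin 4 → VP3} (hdeg : ∀ i, degVle (p i) r)
    (hn : ∀ i j, i ≠ j →
      linForm (N i - N j) ∣ ∑ c, C ((N i - N j) c) * (p i c - p j c))
    (hdiv : ∀ i, pdiv (p i) = 0) :
    ∃ q : Fin 4 → VP3, (∀ i, degVle (q i) (r + 1)) ∧
      (∀ i j c, linForm (N i - N j) ∣ q i c - q j c) ∧ ∀ i, pcurl (q i) = p i := by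
  have hw (i j : Fin 4) (hij : i ≠ j) (c : Fin 3) :
      linForm (N i - N j) ∣ (koszul (p i) c - koszul (p j) c) -
        (∑ e, C (v i e) * (koszul (p i) e - koszul (p j) e)) * C ((N i - N j) c) := by
    have := linForm_dvd_koszul (v := v i) (by simp [hNv, hij.symm]) (hn i j hij) c
    rwa [show (fun c => p i c - p j c) = p i - p j from rfl, koszul_sub] at this
  obtain ⟨φ, hφ⟩ := exists_sub_pgrad_dvd hNv hw
  let t : ℕ → ℕ → ℝ := fun n k => if k ≤ n then 1 else 0
  refine ⟨fun i c => radialMul (t (r + 1)) ((koszul (p i) - pgrad (φ i)) c), ?_, ?_, ?_⟩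
  · intro i c
    exact totalDegree_radialMul_le (fun k hk => if_neg hk.not_ge) _
  · intro i j c
    rw [← map_sub]
    exact linForm_dvd_radialMul _ (hφ i j c)
  · intro i
    have hcurl : pcurl (koszul (p i) - pgrad (φ i)) = p i := by
      rw [pcurl_sub_pgrad, pcurl_koszul (hdiv i)]
    funext c
    have hc := congrFun hcurl c
    simp only [pcurl] at hc ⊢
    rw [pderiv_radialMul, pderiv_radialMul, ← map_sub, hc]
    refine radialMul_eq_self fun k hk => if_pos ?_
    have := hdeg i c
    omega

/-- The substitution `f ↦ f(· + z)`. -/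
def shiftArg (z : V3) : P3 →ₐ[ℝ] P3 := aeval fun c => X c + C (z c)

theorem eval_shiftArg (z y : V3) (f : P3) : eval y (shiftArg z f) = eval (y + z) f := by
  have h : (aeval y : P3 →ₐ[ℝ] ℝ).comp (shiftArg z) = aeval (y + z) := by
    refine MvPolynomial.algHom_ext fun c => ?_
    simp [shiftArg]
  exact DFunLike.congr_fun h f

theorem shiftArg_neg_shiftArg (z : V3) (f : P3) : shiftArg (-z) (shiftArg z f) = f := by
  apply MvPolynomial.funext
  intro y
  simp [eval_shiftArg]

theorem pderiv_shiftArg (z : V3) (c : Fin 3) (f : P3) :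
    pderiv c (shiftArg z f) = shiftArg z (pderiv c f) := by
  induction f using MvPolynomial.induction_on with
  | C a => simp [shiftArg]
  | add f g hf hg => simp [hf, hg]
  | mul_X f e hf =>
    rw [map_mul, pderiv_mul, pderiv_mul, hf, map_add, map_mul, map_mul]
    congr 2
    by_cases h : e = c
    · subst h; simp [shiftArg]
    · simp [shiftArg, pderiv_X_of_ne h]

theorem totalDegree_shiftArg_le (z : V3) (f : P3) :
    (shiftArg z f).totalDegree ≤ f.totalDegree := by
  conv_lhs => rw [f.as_sum, map_sum]
  refine totalDegree_finsetSum_le fun d hd => ?_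
  refine le_trans ?_ (le_totalDegree hd)
  rw [shiftArg, aeval_monomial, algebraMap_eq, Finsupp.prod]
  refine (totalDegree_mul _ _).trans ?_
  rw [totalDegree_C, zero_add]
  refine (totalDegree_finsetProd _ _).trans (Finset.sum_le_sum fun c _ => ?_)
  refine (totalDegree_pow _ _).trans ?_
  have h : (X c + C (z c) : P3).totalDegree ≤ 1 :=
    (totalDegree_add _ _).trans (by simp)
  simpa using Nat.mul_le_mul_left (d c) h

/-- Gradients of the barycentric coordinates of a tetrahedron. -/
theorem exists_barycentric_gradient {x : Fin 4 → V3} (hx : AffineIndependent ℝ x) :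
    ∃ N : Fin 4 → V3, (∀ i j, N i ⬝ᵥ (x j - bary x) = (if i = j then 1 else 0) - 4⁻¹) ∧
      ∀ w, ∑ m, (4⁻¹ + N m ⬝ᵥ w) = 1 ∧ ∑ m, (4⁻¹ + N m ⬝ᵥ w) • x m = bary x + w := by
  have htop : affineSpan ℝ (Set.range x) = ⊤ := by
    rw [hx.affineSpan_eq_top_iff_card_eq_finrank_add_one]
    simp
  let B : AffineBasis (Fin 4) ℝ V3 := ⟨x, hx, htop⟩
  have hBx (i j : Fin 4) : B.coord i (x j) = if i = j then 1 else 0 := B.coord_apply i j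
  have hlin (i : Fin 4) (w : V3) :
      (fun c => (B.coord i).linear (Pi.single c 1)) ⬝ᵥ w = (B.coord i).linear w := by
    conv_rhs => rw [pi_eq_sum_univ' w]
    simp [dotProduct, mul_comm]
  have hbary : bary x = Finset.univ.affineCombination ℝ x (fun _ => (4 : ℝ)⁻¹) := by
    rw [Finset.affineCombination_eq_linear_combination _ _ _ (by simp)]
    simp [bary, Fin.sum_univ_four]
  have hcb (i : Fin 4) : B.coord i (bary x) = 4⁻¹ := by
    rw [hbary]
    exact B.coord_apply_combination_of_mem (Finset.mem_univ i) (by simp)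
  have hcoord (i : Fin 4) (w : V3) :
      4⁻¹ + (fun c => (B.coord i).linear (Pi.single c 1)) ⬝ᵥ w = B.coord i (bary x + w) := by
    rw [hlin, add_comm (bary x), ← vadd_eq_add w, AffineMap.map_vadd, hcb, vadd_eq_add, add_comm]
  refine ⟨fun i c => (B.coord i).linear (Pi.single c 1), fun i j => ?_, fun w => ⟨?_, ?_⟩⟩
  · have h := hcoord i (x j - bary x)
    rw [add_sub_cancel, hBx] at h
    linarith
  · simp only [hcoord]
    exact B.sum_coord_apply_eq_one _
  · simp only [hcoord]
    exact B.linear_combination_coord_eq_self _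

theorem mem_intFace {x : Fin 4 → V3} {i j : Fin 4} (hij : i ≠ j) {β : Fin 4 → ℝ}
    (hsum : ∑ m, β m = 1) (hβ : β i = β j) (h0 : 0 ≤ β i) (hle : ∀ m, β i ≤ β m) :
    ∑ m, β m • x m ∈ intFace x i j := by
  have hx : ∑ m, ((β m - β i) + if m = i ∨ m = j then 2 * β i else 0) •
      (if m = i ∨ m = j then bary x else x m) = ∑ m, β m • x m := by
    have h (m : Fin 4) : ((β m - β i) + if m = i ∨ m = j then 2 * β i else 0) •
        (if m = i ∨ m = j then bary x else x m) = (β m • x m - β i • x m) +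
          ((if m = i then (2 * β i) • bary x else 0) +
            if m = j then (2 * β i) • bary x else 0) := by
      by_cases hmi : m = i
      · subst hmi; simp [hij]
      · by_cases hmj : m = j
        · subst hmj; simp [hβ, hmi]
        · simp [hmi, hmj, sub_smul]
    rw [Finset.sum_congr rfl fun m _ => h m]
    simp only [Finset.sum_add_distrib, Finset.sum_sub_distrib, Finset.sum_ite_eq',
      Finset.mem_univ, if_true, Fin.sum_univ_four, bary]
    module
  rw [← hx]
  refine (convex_convexHull ℝ _).sum_mem (fun m _ => ?_) ?_ fun m _ => subset_convexHull ℝ _ ?_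
  · have := hle m
    split_ifs <;> linarith
  · have h (m : Fin 4) : (if m = i ∨ m = j then 2 * β i else 0)
        = (if m = i then 2 * β i else 0) + if m = j then 2 * β i else 0 := by
      by_cases hmi : m = i
      · subst hmi; simp [hij]
      · simp [hmi]
    simp only [h, Finset.sum_add_distrib, Finset.sum_sub_distrib, hsum, Finset.sum_ite_eq',
      Finset.mem_univ, if_true]
    simp
    ring
  · split_ifs with hm
    · exact Set.mem_insert _ _
    · rw [not_or] at hm
      exact Set.mem_insert_of_mem _ ⟨m, hm, rfl⟩

theorem dotProduct_eq_zero_of_mem_intFace {x : Fin 4 → V3} {i j : Fin 4} {n : V3}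
    (hn : ∀ k, k ≠ i → k ≠ j → n ⬝ᵥ (x k - bary x) = 0) {y : V3} (hy : y ∈ intFace x i j) :
    n ⬝ᵥ (y - bary x) = 0 := by
  have hconv : Convex ℝ {y : V3 | n ⬝ᵥ (y - bary x) = 0} := by
    intro a ha b hb s t _ _ hst
    simp only [Set.mem_ofPred_eq, dotProduct_sub, dotProduct_add, dotProduct_smul,
      smul_eq_mul] at ha hb ⊢
    linear_combination s * ha + t * hb + (n ⬝ᵥ bary x) * hst
  refine convexHull_min ?_ hconv hy
  rintro _ (rfl | ⟨k, ⟨hki, hkj⟩, rfl⟩)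
  · simp
  · exact hn k hki hkj

/-- Vanishing on an interior face, stated as divisibility. -/
theorem linForm_dvd_of_forall_mem_intFace {x N : Fin 4 → V3}
    (hN : ∀ i j, N i ⬝ᵥ (x j - bary x) = (if i = j then 1 else 0) - 4⁻¹)
    (hw : ∀ w, ∑ m, (4⁻¹ + N m ⬝ᵥ w) = 1 ∧ ∑ m, (4⁻¹ + N m ⬝ᵥ w) • x m = bary x + w)
    {i j : Fin 4} (hij : i ≠ j) {f : P3}
    (hf : ∀ y ∈ intFace x i j, eval (y - bary x) f = 0) : linForm (N i - N j) ∣ f := by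
  have hnv : (N i - N j) ⬝ᵥ (x i - bary x) = 1 := by
    rw [sub_dotProduct, hN, hN]
    simp [hij.symm]
  have hy₀ (m : Fin 4) : N m ⬝ᵥ ((-8⁻¹ : ℝ) • (x i - bary x) + (-8⁻¹ : ℝ) • (x j - bary x)) =
      16⁻¹ - 8⁻¹ * ((if m = i then 1 else 0) + if m = j then 1 else 0) := by
    rw [dotProduct_add, dotProduct_smul, dotProduct_smul, hN, hN, smul_eq_mul, smul_eq_mul]
    ring
  generalize (-8⁻¹ : ℝ) • (x i - bary x) + (-8⁻¹ : ℝ) • (x j - bary x) = y₀ at hy₀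
  have hny₀ : (N i - N j) ⬝ᵥ y₀ = 0 := by
    rw [sub_dotProduct, hy₀, hy₀]
    simp [hij, hij.symm]
  generalize x i - bary x = v at hnv
  have hcont (m : Fin 4) :
      Continuous fun y : V3 => N m ⬝ᵥ (y - ((N i - N j) ⬝ᵥ y) • v) := by
    unfold dotProduct
    fun_prop
  have hpos : ∀ᶠ y in nhds y₀, -4⁻¹ < N i ⬝ᵥ (y - ((N i - N j) ⬝ᵥ y) • v) := by
    refine ((hcont i).tendsto y₀).eventually_const_lt ?_
    rw [hny₀, zero_smul, sub_zero, hy₀]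
    simp only [if_true, if_neg hij]
    norm_num
  have hlt : ∀ᶠ y in nhds y₀, ∀ m, m ≠ i → m ≠ j →
      N i ⬝ᵥ (y - ((N i - N j) ⬝ᵥ y) • v) < N m ⬝ᵥ (y - ((N i - N j) ⬝ᵥ y) • v) := by
    refine Filter.eventually_all.2 fun m => ?_
    by_cases hm : m ≠ i ∧ m ≠ j
    · refine (((hcont i).tendsto y₀).eventually_lt ((hcont m).tendsto y₀) ?_).mono
        fun y hy _ _ => hy
      rw [hny₀, zero_smul, sub_zero, hy₀, hy₀]
      simp only [if_true, if_neg hij, if_neg hm.1, if_neg hm.2]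
      norm_num
    · exact Filter.Eventually.of_forall fun y h h' => absurd ⟨h, h'⟩ hm
  refine linForm_dvd_of_eventually hnv (y₀ := y₀) ?_
  filter_upwards [hpos, hlt] with y hy hy'
  have heq : N i ⬝ᵥ (y - ((N i - N j) ⬝ᵥ y) • v) = N j ⬝ᵥ (y - ((N i - N j) ⬝ᵥ y) • v) := by
    rw [← sub_eq_zero, ← sub_dotProduct, dotProduct_sub, dotProduct_smul, hnv, smul_eq_mul,
      mul_one, sub_self]
  generalize y - ((N i - N j) ⬝ᵥ y) • v = w at *
  have hmem := mem_intFace (x := x) (β := fun m => 4⁻¹ + N m ⬝ᵥ w) hij (hw w).1 (by rw [heq])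
    (by linarith) fun m => ?_
  · rw [(hw w).2] at hmem
    simpa using hf _ hmem
  · by_cases hmi : m = i
    · rw [hmi]
    · by_cases hmj : m = j
      · rw [hmj, heq]
      · linarith [hy' m hmi hmj]

theorem dotProduct_eq_zero_of_forall_isUnitNormalInt {x : Fin 4 → V3} {i j : Fin 4} {n a : V3}
    (hn : ∀ k, k ≠ i → k ≠ j → n ⬝ᵥ (x k - bary x) = 0)
    (h : ∀ n, IsUnitNormalInt x i j n → a ⬝ᵥ n = 0) : a ⬝ᵥ n = 0 := by
  by_cases h0 : n = 0
  · simp [h0]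
  have hpos : 0 < n ⬝ᵥ n :=
    (Finset.sum_nonneg fun c _ => mul_self_nonneg (n c)).lt_of_ne
      fun h => h0 (dotProduct_self_eq_zero.1 h.symm)
  have hs : √(n ⬝ᵥ n) ≠ 0 := (Real.sqrt_pos.2 hpos).ne'
  have := h ((√(n ⬝ᵥ n))⁻¹ • n) ⟨?_, fun k hki hkj => ?_⟩
  · rw [dotProduct_smul, smul_eq_mul] at this
    exact (mul_eq_zero.1 this).resolve_left (inv_ne_zero hs)
  · rw [smul_dotProduct, dotProduct_smul, smul_eq_mul, smul_eq_mul]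
    nth_rw 3 [← Real.mul_self_sqrt hpos.le]
    field_simp
  · rw [smul_dotProduct, hn k hki hkj, smul_zero]

end Alfeld

/-- divergence-free piecewise polynomial vector fields on an Alfeld split with
single-valued normal traces on interior faces are curls of continuous piecewise polynomial
vector fields. -/
theorem statement3 (r : ℕ) (x : Fin 4 → V3) (hx : AffineIndependent ℝ x)
    (p : Fin 4 → VP3) (hdeg : ∀ i, degVle (p i) r)
    (hnormInt : ∀ i j, i ≠ j → ∀ n, IsUnitNormalInt x i j n →
      ∀ y ∈ intFace x i j, (evalV (p i) y - evalV (p j) y) ⬝ᵥ n = 0)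
    (hdiv : ∀ i, pdiv (p i) = 0) :
    ∃ q : Fin 4 → VP3,
      (∀ i, degVle (q i) (r + 1)) ∧
      (∀ i j, i ≠ j → ∀ y ∈ intFace x i j, evalV (q i) y = evalV (q j) y) ∧
      (∀ i, pcurl (q i) = p i) := by
  obtain ⟨N, hN, hw⟩ := exists_barycentric_gradient hx
  have hNv (i j k : Fin 4) : (N i - N j) ⬝ᵥ (x k - bary x) =
      (if i = k then 1 else 0) - (if j = k then 1 else 0) := by
    rw [sub_dotProduct, hN, hN]
    ring
  have hface (i j k : Fin 4) (hki : k ≠ i) (hkj : k ≠ j) :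
      (N i - N j) ⬝ᵥ (x k - bary x) = 0 := by
    rw [hNv, if_neg hki.symm, if_neg hkj.symm, sub_zero]
  obtain ⟨q, hqdeg, hqcont, hqcurl⟩ := exists_continuous_potential
    (p := fun i c => shiftArg (bary x) (p i c)) (r := r) hNv
    (fun i c => (totalDegree_shiftArg_le _ _).trans (hdeg i c))
    (fun i j hij => by
      refine linForm_dvd_of_forall_mem_intFace hN hw hij fun y hy => ?_
      have h := dotProduct_eq_zero_of_forall_isUnitNormalInt (hface i j)
        fun n hn => hnormInt i j hij n hn y hy
      rw [dotProduct_comm] at h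
      simpa [eval_shiftArg, dotProduct, evalV] using h)
    (fun i => by
      have h := congrArg (shiftArg (bary x)) (hdiv i)
      simpa only [pdiv, map_sum, pderiv_shiftArg, map_zero] using h)
  refine ⟨fun i c => shiftArg (-bary x) (q i c),
    fun i c => (totalDegree_shiftArg_le _ _).trans (hqdeg i c), fun i j _ y hy => ?_, fun i => ?_⟩
  · funext c
    simp only [evalV, eval_shiftArg, ← sub_eq_add_neg]
    exact eval_eq_of_linForm_dvd (hqcont i j c) (dotProduct_eq_zero_of_mem_intFace (hface i j) hy)
  · funext c
    have h := congrArg (shiftArg (-bary x)) (congrFun (hqcurl i) c)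
    rw [shiftArg_neg_shiftArg] at h
    simpa only [pcurl, map_sub, pderiv_shiftArg] using h
end
end

section
/- Let r ≥ 0 be an integer. Suppose (p₀,p₁,p₂,p₃) is a piecewise polynomial vector field of degree ≤ r on the Alfeld split T^z of a tetrahedron T ⊂ ℝ³ such that its tangential components are single-valued across interior faces ((p_i − p_j) × n_{ij} = 0 at every point of F_{ij} for all i ≠ j) and curl p_i = 0 identically for each i. Then there exists a piecewise polynomial scalar field (q₀,q₁,q₂,q₃) of degree ≤ r+1 on T^z which is continuous across interior faces (q_i = q_j on F_{ij} for all i ≠ j) and satisfies grad q_i = p_i for each i. -/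
open MvPolynomial Matrix

noncomputable section

open Alfeld

section Poincare

variable {σ K : Type*} [Field K]

/-- The linear operator dividing each monomial of degree `n` by `n + k + 1`; on polynomials it is
`p ↦ ∫ t in 0..1, t ^ k * p (t y)`. -/
def MvPolynomial.radialIntegral (k : ℕ) : MvPolynomial σ K →ₗ[K] MvPolynomial σ K :=
  (basisMonomials σ K).constr K fun m => monomial m ((m.degree + k + 1 : K)⁻¹)

theorem MvPolynomial.radialIntegral_monomial (k : ℕ) (m : σ →₀ ℕ) (a : K) :
    radialIntegral k (monomial m a) = monomial m ((m.degree + k + 1 : K)⁻¹ * a) := by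
  have h : monomial m a = a • basisMonomials σ K m := by
    simp [coe_basisMonomials, smul_monomial]
  rw [h, map_smul, radialIntegral, Module.Basis.constr_basis, smul_monomial, smul_eq_mul, mul_comm]

theorem MvPolynomial.coeff_radialIntegral (k : ℕ) (m : σ →₀ ℕ) (p : MvPolynomial σ K) :
    coeff m (radialIntegral k p) = (m.degree + k + 1 : K)⁻¹ * coeff m p := by
  classical
  induction p using MvPolynomial.induction_on' with
  | monomial u a =>
    rw [radialIntegral_monomial, coeff_monomial, coeff_monomial]
    split_ifs with h <;> simp [h]
  | add p q hp hq => rw [map_add, coeff_add, coeff_add, hp, hq, mul_add]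

theorem MvPolynomial.totalDegree_radialIntegral_le (k : ℕ) (p : MvPolynomial σ K) :
    (radialIntegral k p).totalDegree ≤ p.totalDegree := by
  refine totalDegree_le_of_support_subset fun m hm => ?_
  rw [mem_support_iff, coeff_radialIntegral] at hm
  exact mem_support_iff.2 (right_ne_zero_of_mul hm)

theorem MvPolynomial.pderiv_radialIntegral (i : σ) (k : ℕ) (p : MvPolynomial σ K) :
    pderiv i (radialIntegral k p) = radialIntegral (k + 1) (pderiv i p) := by
  induction p using MvPolynomial.induction_on' with
  | monomial u a =>
    rw [radialIntegral_monomial, pderiv_monomial, pderiv_monomial, radialIntegral_monomial]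
    by_cases h : u i = 0
    · simp [h]
    · have hle : Finsupp.single i 1 ≤ u := by
        simpa using Nat.one_le_iff_ne_zero.2 h
      have hdeg : ((u - Finsupp.single i 1).degree : K) + 1 = u.degree := by
        conv_rhs => rw [← tsub_add_cancel_of_le hle]
        simp [map_add]
      congr 1
      rw [← hdeg]
      push_cast
      ring
  | add p q hp hq => simp only [map_add, hp, hq]

theorem MvPolynomial.radialIntegral_euler [CharZero K] [Fintype σ] (p : MvPolynomial σ K) :
    radialIntegral 0 p + ∑ i, X i * pderiv i (radialIntegral 0 p) = p := by
  induction p using MvPolynomial.induction_on' with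
  | monomial u a =>
    have hne : (u.degree + 1 : K) ≠ 0 := by exact_mod_cast u.degree.succ_ne_zero
    simp_rw [radialIntegral_monomial, X_mul_pderiv_monomial, ← Finset.sum_smul, smul_monomial,
      ← map_add, ← Finsupp.degree_eq_sum]
    congr 1
    rw [nsmul_eq_mul]
    push_cast
    rw [add_zero]
    field_simp
    ring
  | add p q hp hq =>
    conv_rhs => rw [← hp, ← hq]
    simp only [map_add, mul_add, Finset.sum_add_distrib]
    ring

/-- The polynomial Poincaré lemma in degree one. -/
theorem MvPolynomial.exists_pderiv_eq_of_pderiv_comm [CharZero K] [Fintype σ] (r : ℕ)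
    (p : σ → MvPolynomial σ K) (hdeg : ∀ c, (p c).totalDegree ≤ r)
    (hp : ∀ c d, pderiv d (p c) = pderiv c (p d)) :
    ∃ q : MvPolynomial σ K, q.totalDegree ≤ r + 1 ∧ ∀ c, pderiv c q = p c := by
  classical
  refine ⟨∑ c, X c * radialIntegral 0 (p c), ?_, fun d => ?_⟩
  · refine totalDegree_finsetSum_le fun c _ => (totalDegree_mul _ _).trans ?_
    rw [totalDegree_X, add_comm]
    exact Nat.add_le_add_right ((totalDegree_radialIntegral_le 0 _).trans (hdeg c)) 1
  · conv_rhs => rw [← radialIntegral_euler (p d)]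
    simp_rw [map_sum, pderiv_mul, pderiv_radialIntegral, hp _ d, Finset.sum_add_distrib]
    congr 1
    simp [pderiv_X, Pi.single_apply]

end Poincare

theorem MvPolynomial.hasDerivAt_eval_add_smul {σ : Type*} [Fintype σ] (q : MvPolynomial σ ℝ)
    (z v : σ → ℝ) (t : ℝ) :
    HasDerivAt (fun s : ℝ => eval (z + s • v) q) (∑ c, eval (z + t • v) (pderiv c q) * v c) t := by
  classical
  induction q using MvPolynomial.induction_on with
  | C a => simpa using hasDerivAt_const t a
  | add p q hp hq =>
    simp only [map_add, add_mul, Finset.sum_add_distrib]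
    exact hp.add hq
  | mul_X p i hp =>
    have hi : HasDerivAt (fun s : ℝ => z i + s * v i) (v i) t := by
      simpa using ((hasDerivAt_id t).mul_const (v i)).const_add (z i)
    simp only [map_mul, eval_X, Pi.add_apply, Pi.smul_apply, smul_eq_mul]
    refine (hp.mul hi).congr_deriv ?_
    simp only [pderiv_mul, pderiv_X, Pi.single_apply, map_add, map_mul, add_mul,
      Finset.sum_add_distrib, eval_X, Pi.add_apply, Pi.smul_apply, smul_eq_mul, Finset.sum_mul]
    congr 1
    · exact Finset.sum_congr rfl fun c _ => by ring
    · simp [apply_ite]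

/-- Constancy along segments of a polynomial with vanishing directional derivative. -/
theorem MvPolynomial.eval_eq_eval_of_segment {σ : Type*} [Fintype σ] (q : MvPolynomial σ ℝ)
    (z y : σ → ℝ)
    (h : ∀ w ∈ segment ℝ z y, ∑ c, eval w (pderiv c q) * (y - z) c = 0) :
    eval y q = eval z q := by
  have hd (t : ℝ) := hasDerivAt_eval_add_smul q z (y - z) t
  have key := constant_of_has_deriv_right_zero (a := (0 : ℝ)) (b := 1)
    (f := fun s : ℝ => eval (z + s • (y - z)) q)
    (fun t _ => (hd t).continuousAt.continuousWithinAt)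
    (fun t ht => by
      have := (hd t).hasDerivWithinAt (s := Set.Ici t)
      rwa [h] at this
      rw [segment_eq_image']
      exact ⟨t, ⟨ht.1, ht.2.le⟩, rfl⟩) 1 ⟨zero_le_one, le_rfl⟩
  simpa using key

namespace Alfeld

theorem exists_unit_normal (u v : V3) : ∃ n : V3, n ⬝ᵥ n = 1 ∧ n ⬝ᵥ u = 0 ∧ n ⬝ᵥ v = 0 := by
  obtain ⟨n, hn, h⟩ := Matrix.exists_mulVec_eq_zero_iff.2
    (show (!![u 0, u 1, u 2; v 0, v 1, v 2; 0, 0, 0] : Matrix (Fin 3) (Fin 3) ℝ).det = 0 by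
      simp [Matrix.det_fin_three])
  have hu := congrFun h 0
  have hv := congrFun h 1
  simp only [mulVec, dotProduct, Fin.sum_univ_three, of_apply, cons_val, Pi.zero_apply] at hu hv
  have hpos : 0 < n ⬝ᵥ n := by
    have h0 : n ⬝ᵥ n ≠ 0 := fun h0 => hn (dotProduct_self_eq_zero.1 h0)
    refine lt_of_le_of_ne ?_ h0.symm
    exact Finset.sum_nonneg fun c _ => mul_self_nonneg (n c)
  refine ⟨(√(n ⬝ᵥ n))⁻¹ • n, ?_, ?_, ?_⟩
  · rw [smul_dotProduct, dotProduct_smul, smul_eq_mul, smul_eq_mul, ← mul_assoc, ← mul_inv,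
      Real.mul_self_sqrt hpos.le, inv_mul_cancel₀ hpos.ne']
  · rw [smul_dotProduct, smul_eq_mul, mul_eq_zero]
    right
    simp only [dotProduct, Fin.sum_univ_three]
    linarith
  · rw [smul_dotProduct, smul_eq_mul, mul_eq_zero]
    right
    simp only [dotProduct, Fin.sum_univ_three]
    linarith

theorem exists_isUnitNormalInt (x : Fin 4 → V3) {i j : Fin 4} (hij : i ≠ j) :
    ∃ n, IsUnitNormalInt x i j n := by
  have hkl : ∀ i j : Fin 4, i ≠ j → ∃ k l, ∀ m, m ≠ i → m ≠ j → m = k ∨ m = l := by decide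
  obtain ⟨k, l, h⟩ := hkl i j hij
  obtain ⟨n, hn, hk, hl⟩ := exists_unit_normal (x k - bary x) (x l - bary x)
  refine ⟨n, hn, fun m hi hj => ?_⟩
  obtain rfl | rfl := h m hi hj
  · exact hk
  · exact hl

theorem IsUnitNormalInt.dotProduct_sub_bary {x : Fin 4 → V3} {i j : Fin 4} {n y : V3}
    (hn : IsUnitNormalInt x i j n) (hy : y ∈ intFace x i j) : n ⬝ᵥ (y - bary x) = 0 := by
  have hconv : Convex ℝ {y : V3 | n ⬝ᵥ y = n ⬝ᵥ bary x} :=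
    convex_hyperplane ⟨fun a b => dotProduct_add n a b, fun c a => dotProduct_smul c n a⟩ _
  rw [dotProduct_sub, sub_eq_zero]
  refine convexHull_min ?_ hconv hy
  rintro _ (rfl | ⟨k, hk, rfl⟩)
  · rfl
  · have := hn.2 k hk.1 hk.2
    rwa [dotProduct_sub, sub_eq_zero] at this

theorem dotProduct_eq_zero_of_cross3_eq_zero {g n v : V3} (hn : n ⬝ᵥ n = 1)
    (hg : cross3 g n = 0) (hv : n ⬝ᵥ v = 0) : g ⬝ᵥ v = 0 := by
  have h0 := congrFun hg 0
  have h1 := congrFun hg 1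
  have h2 := congrFun hg 2
  simp only [cross3, Pi.zero_apply, Fin.isValue, Fin.reduceAdd, zero_add] at h0 h1 h2
  simp only [dotProduct, Fin.sum_univ_three] at *
  linear_combination (-(g 0 * v 0 + g 1 * v 1 + g 2 * v 2)) * hn
    + (g 0 * n 0 + g 1 * n 1 + g 2 * n 2) * hv
    + (v 1 * n 2 - v 2 * n 1) * h0 + (v 2 * n 0 - v 0 * n 2) * h1
    + (v 0 * n 1 - v 1 * n 0) * h2

theorem pderiv_comm_of_pcurl_eq_zero {p : VP3} (h : pcurl p = 0) (c d : Fin 3) :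
    pderiv d (p c) = pderiv c (p d) := by
  have h0 := sub_eq_zero.1 (congrFun h 0)
  have h1 := sub_eq_zero.1 (congrFun h 1)
  have h2 := sub_eq_zero.1 (congrFun h 2)
  simp only [Fin.isValue, Fin.reduceAdd, zero_add] at h0 h1 h2
  fin_cases c <;> fin_cases d <;> first | rfl | assumption | (symm; assumption)

/-- A curl-free polynomial vector field has a polynomial potential vanishing at a given point. -/
theorem exists_potential {p : VP3} {r : ℕ} (hdeg : degVle p r) (hcurl : pcurl p = 0) (z : V3) :
    ∃ q : P3, q.totalDegree ≤ r + 1 ∧ eval z q = 0 ∧ pgrad q = p := by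
  obtain ⟨q, hq, hqp⟩ :=
    exists_pderiv_eq_of_pderiv_comm r p hdeg (pderiv_comm_of_pcurl_eq_zero hcurl)
  refine ⟨q - C (eval z q), (totalDegree_sub_C_le q _).trans hq, by simp, ?_⟩
  ext1 c
  simp [pgrad, hqp]

end Alfeld

/-- curl-free piecewise polynomial vector fields on an Alfeld split with
single-valued tangential traces on interior faces are gradients of continuous piecewise
polynomial scalar fields. -/
theorem statement4 (r : ℕ) (x : Fin 4 → V3) (hx : AffineIndependent ℝ x)
    (p : Fin 4 → VP3) (hdeg : ∀ i, degVle (p i) r)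
    (htangInt : ∀ i j, i ≠ j → ∀ n, IsUnitNormalInt x i j n →
      ∀ y ∈ intFace x i j, cross3 (evalV (p i) y - evalV (p j) y) n = 0)
    (hcurl : ∀ i, pcurl (p i) = 0) :
    ∃ q : Fin 4 → P3,
      (∀ i, (q i).totalDegree ≤ r + 1) ∧
      (∀ i j, i ≠ j → ∀ y ∈ intFace x i j, eval y (q i) = eval y (q j)) ∧
      (∀ i, pgrad (q i) = p i) := by
  choose q hq hz hgrad using fun i => exists_potential (hdeg i) (hcurl i) (bary x)
  refine ⟨q, hq, fun i j hij y hy => ?_, hgrad⟩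
  obtain ⟨n, hn⟩ := exists_isUnitNormalInt x hij
  have hbary : bary x ∈ intFace x i j := subset_convexHull ℝ _ (Set.mem_insert _ _)
  have hseg := (convex_convexHull ℝ _).segment_subset hbary hy
  have key := eval_eq_eval_of_segment (q i - q j) (bary x) y fun w hw => by
    have h := dotProduct_eq_zero_of_cross3_eq_zero hn.1 (htangInt i j hij n hn w (hseg hw))
      (hn.dotProduct_sub_bary hy)
    rw [← hgrad i, ← hgrad j] at h
    simpa only [dotProduct, evalV, pgrad, Pi.sub_apply, map_sub] using h
  rwa [map_sub, map_sub, hz, hz, sub_self, sub_eq_zero] at key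
end
end
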